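/- Let D be a vertex-weighted oriented graph, let x_i be a sink of D (a vertex with only arrows entering it), and let D' be the vertex-weighted oriented graph obtained from D by replacing the weight d_i with 1. Then I(D) is Cohen–Macaulay if and only if I(D') is Cohen–Macaulay. -/

import Mathlib

open MvPolynomial

noncomputable section

open RingTheory.Sequence in
/-- A (graded) ideal `I` of `R = K[x_1, …, x_n]` is Cohen–Macaulay if `R/I` is a
Cohen–Macaulay ring, i.e. there is a regular sequence on `R/I`, contained in the irrelevant
maximal ideal `(x_1, …, x_n)`, whose length equals the Krull dimension of `R/I`. -/
def IsCohenMacaulayIdeal {n : ℕ} {K : Type*} [Field K]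
    (I : Ideal (MvPolynomial (Fin n) K)) : Prop :=
  ∃ rs : List (MvPolynomial (Fin n) K),
    (∀ f ∈ rs, f ∈ Ideal.span (Set.range (X : Fin n → MvPolynomial (Fin n) K))) ∧
    IsRegular (MvPolynomial (Fin n) K ⧸ I) rs ∧
    (rs.length : WithBot ℕ∞) = ringKrullDim (MvPolynomial (Fin n) K ⧸ I)

/-- A vertex-weighted oriented graph on the vertex set `{x_1, …, x_n}`: a digraph with no
loops and no oriented cycles of length two, together with a positive integer weight `d i`
attached to each vertex. -/
structure WOG (n : ℕ) where
  E : Fin n → Fin n → Prop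
  irrefl : ∀ i, ¬ E i i
  no_two_cycles : ∀ i j, E i j → ¬ E j i
  d : Fin n → ℕ
  dpos : ∀ i, 1 ≤ d i

/-- The edge ideal `I(D) = (x_i x_j^{d_j} : (x_i, x_j) ∈ E(D))` of a vertex-weighted
oriented graph `D`. -/
def edgeIdeal (K : Type*) [Field K] {n : ℕ} (D : WOG n) : Ideal (MvPolynomial (Fin n) K) :=
  Ideal.span {f | ∃ i j, D.E i j ∧ f = X i * (X j : MvPolynomial (Fin n) K) ^ D.d j}

open RingTheory.Sequence TensorProduct

section DepthExchange

universe u v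

variable {A : Type u} [CommRing A]

/-- The ideal `J` contains a weakly regular sequence of length `d` on `M`. -/
def HasWeaklyRegularSeq (J : Ideal A) (M : Type v) [AddCommGroup M] [Module A M] (d : ℕ) : Prop :=
  ∃ rs : List A, (∀ r ∈ rs, r ∈ J) ∧ IsWeaklyRegular M rs ∧ rs.length = d

variable {M : Type v} [AddCommGroup M] [Module A M] {J : Ideal A}

lemma hasWeaklyRegularSeq_zero : HasWeaklyRegularSeq J M 0 :=
  ⟨[], by simp, .nil A M, rfl⟩

lemma hasWeaklyRegularSeq_succ_iff {d : ℕ} :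
    HasWeaklyRegularSeq J M (d + 1) ↔
      ∃ a ∈ J, IsSMulRegular M a ∧ HasWeaklyRegularSeq J (QuotSMulTop a M) d := by
  constructor
  · rintro ⟨_ | ⟨a, rs⟩, hJ, hreg, hlen⟩
    · simp at hlen
    · rw [isWeaklyRegular_cons_iff] at hreg
      exact ⟨a, hJ a (by simp), hreg.1, rs, fun r hr => hJ r (by simp [hr]), hreg.2,
        by simpa using hlen⟩
  · rintro ⟨a, ha, hreg, rs, hJ, hrs, rfl⟩
    refine ⟨a :: rs, ?_, .cons hreg hrs, rfl⟩
    simpa [ha] using hJ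

lemma HasWeaklyRegularSeq.congr {M' : Type*} [AddCommGroup M'] [Module A M'] {d : ℕ}
    (e : M ≃ₗ[A] M') (h : HasWeaklyRegularSeq J M d) : HasWeaklyRegularSeq J M' d := by
  obtain ⟨rs, hJ, hrs, hlen⟩ := h
  exact ⟨rs, hJ, (e.isWeaklyRegular_congr rs).mp hrs, hlen⟩

/-- Over a Noetherian ring, if no nonzero element of a finite module is killed by `J`, then `J`
contains a regular element. -/
lemma exists_mem_isSMulRegular [IsNoetherianRing A] [Module.Finite A M]
    (h : ∀ x : M, (∀ a ∈ J, a • x = 0) → x = 0) : ∃ b ∈ J, IsSMulRegular M b := by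
  by_contra! hcon
  have hsub : (J : Set A) ⊆ ⋃ p ∈ associatedPrimes A M, (p : Set A) := by
    rw [biUnion_associatedPrimes_eq_compl_regular]
    exact fun b hb => hcon b hb
  obtain ⟨p, hp, hJp⟩ := (J.subset_union_prime_finite (associatedPrimes.finite A M) (f := id) 0 0
    fun _ h _ _ => h.isPrime).mp hsub
  rw [AssociatedPrimes.mem_iff, isAssociatedPrime_iff] at hp
  obtain ⟨hprime, x, hx⟩ := hp
  have hx0 : x = 0 := h x fun a ha => by
    have := hJp ha
    simpa [hx, Submodule.mem_colon_singleton] using this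
  apply hprime.ne_top
  simp [hx, hx0]

lemma eq_zero_of_forall_smul_eq_zero_quotSMulTop {a f : A} (hfJ : f ∈ J)
    (ha : IsSMulRegular M a) (hf : IsSMulRegular M f)
    (h : ∀ x : QuotSMulTop f M, (∀ g ∈ J, g • x = 0) → x = 0)
    (x : QuotSMulTop a M) (hx : ∀ g ∈ J, g • x = 0) : x = 0 := by
  obtain ⟨x, rfl⟩ := Submodule.Quotient.mk_surjective _ x
  simp only [← Submodule.Quotient.mk_smul, Submodule.Quotient.mk_eq_zero,
    Submodule.mem_smul_pointwise_iff_exists, Submodule.mem_top, true_and] at hx ⊢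
  obtain ⟨y, hy⟩ := hx f hfJ
  have hy0 := h (Submodule.Quotient.mk y) fun g hg => by
    obtain ⟨z, hz⟩ := hx g hg
    rw [← Submodule.Quotient.mk_smul, Submodule.Quotient.mk_eq_zero,
      Submodule.mem_smul_pointwise_iff_exists]
    refine ⟨z, Submodule.mem_top, ha ?_⟩
    change a • f • z = a • g • y
    rw [smul_comm a f, hz, smul_comm a g, hy, smul_comm]
  rw [Submodule.Quotient.mk_eq_zero, Submodule.mem_smul_pointwise_iff_exists] at hy0
  obtain ⟨y', -, rfl⟩ := hy0
  refine ⟨y', hf ?_⟩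
  change f • a • y' = f • x
  rw [← hy, smul_comm]

lemma IsSMulRegular.quotSMulTop_swap {a b : A} (ha : IsSMulRegular M a)
    (hab : IsSMulRegular (QuotSMulTop a M) b) : IsSMulRegular (QuotSMulTop b M) a := by
  rw [isSMulRegular_quotient_iff_mem_of_smul_mem] at hab ⊢
  intro x hx
  obtain ⟨y, -, hy : b • y = a • x⟩ := Submodule.mem_smul_pointwise_iff_exists _ _ _ |>.mp hx
  obtain ⟨z, -, rfl⟩ := Submodule.mem_smul_pointwise_iff_exists _ _ _ |>.mp <| hab y <| by
    rw [hy]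
    exact Submodule.smul_mem_pointwise_smul _ _ _ Submodule.mem_top
  have : b • z = x := ha <| by
    change a • b • z = a • x
    rw [smul_comm, hy]
  rw [← this]
  exact Submodule.smul_mem_pointwise_smul _ _ _ Submodule.mem_top

/-- Quotients by two elements commute. -/
def quotSMulTopComm (a b : A) (M : Type v) [AddCommGroup M] [Module A M] :
    QuotSMulTop a (QuotSMulTop b M) ≃ₗ[A] QuotSMulTop b (QuotSMulTop a M) :=
  QuotSMulTop.congr a (QuotSMulTop.equivQuotTensor b M) ≪≫ₗ
    (QuotSMulTop.tensorQuotSMulTopEquivQuotSMulTop a (A ⧸ Ideal.span {b}) M).symm ≪≫ₗ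
    (QuotSMulTop.equivQuotTensor b (QuotSMulTop a M)).symm

lemma eq_zero_of_forall_smul_eq_zero {f : A} (hfJ : f ∈ J) (hf : IsSMulRegular M f) (x : M)
    (hx : ∀ g ∈ J, g • x = 0) : x = 0 :=
  hf.right_eq_zero_of_smul (hx f hfJ)

/-- Dividing out any regular element of `J` lowers the available length of weakly regular sequences
in `J` by at most one. -/
lemma HasWeaklyRegularSeq.quotSMulTop [IsNoetherianRing A] {d : ℕ} [Module.Finite A M]
    {a : A} (haJ : a ∈ J) (ha : IsSMulRegular M a) (h : HasWeaklyRegularSeq J M (d + 1)) :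
    HasWeaklyRegularSeq J (QuotSMulTop a M) d := by
  induction d generalizing M a with
  | zero => exact hasWeaklyRegularSeq_zero
  | succ d ih =>
    obtain ⟨f, hfJ, hf, h'⟩ := hasWeaklyRegularSeq_succ_iff.mp h
    obtain ⟨f₂, hf₂J, hf₂, -⟩ := hasWeaklyRegularSeq_succ_iff.mp h'
    have hMf := eq_zero_of_forall_smul_eq_zero (J := J) hf₂J hf₂
    have hMa := eq_zero_of_forall_smul_eq_zero_quotSMulTop hfJ ha hf hMf
    obtain ⟨b, hbJ, hb⟩ := exists_mem_isSMulRegular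
        (J := J) (M := M × QuotSMulTop a M × QuotSMulTop f M) <| by
      rintro ⟨x, y, z⟩ hx
      simp only [Prod.smul_mk, Prod.mk_eq_zero] at hx ⊢
      exact ⟨eq_zero_of_forall_smul_eq_zero hfJ hf x fun g hg => (hx g hg).1,
        hMa y fun g hg => (hx g hg).2.1, hMf z fun g hg => (hx g hg).2.2⟩
    have hbM : IsSMulRegular M b :=
      hb.of_injective (LinearMap.inl A M _) LinearMap.inl_injective
    have hb' := hb.of_injective (LinearMap.inr A M _) LinearMap.inr_injective
    have hba : IsSMulRegular (QuotSMulTop a M) b :=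
      hb'.of_injective (LinearMap.inl A (QuotSMulTop a M) _) LinearMap.inl_injective
    have hbf : IsSMulRegular (QuotSMulTop f M) b :=
      hb'.of_injective (LinearMap.inr A (QuotSMulTop a M) _) LinearMap.inr_injective
    have hMb : HasWeaklyRegularSeq J (QuotSMulTop b M) (d + 1) :=
      hasWeaklyRegularSeq_succ_iff.mpr ⟨f, hfJ, hf.quotSMulTop_swap hbf,
        (ih hbJ hbf h').congr (quotSMulTopComm b f M)⟩
    exact hasWeaklyRegularSeq_succ_iff.mpr ⟨b, hbJ, hba,
      (ih haJ (ha.quotSMulTop_swap hba) hMb).congr (quotSMulTopComm a b M)⟩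

/-- Weakly regular sequences descend along faithfully flat algebras, at the level of lengths. -/
lemma HasWeaklyRegularSeq.of_faithfullyFlat [IsNoetherianRing A] {B : Type*} [CommRing B]
    [Algebra A B] [IsNoetherianRing B] [Module.FaithfullyFlat A B] {m : Ideal A} {J : Ideal B}
    (hmJ : m.map (algebraMap A B) ≤ J) (hJm : J ≤ (m.map (algebraMap A B)).radical) {d : ℕ}
    [Module.Finite A M] (h : HasWeaklyRegularSeq J (B ⊗[A] M) d) : HasWeaklyRegularSeq m M d := by
  induction d generalizing M with
  | zero => exact hasWeaklyRegularSeq_zero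
  | succ d ih =>
    obtain ⟨f, hfJ, hf, -⟩ := hasWeaklyRegularSeq_succ_iff.mp h
    obtain ⟨a, ham, ha⟩ := exists_mem_isSMulRegular (J := m) (M := M) <| by
      intro x hx
      obtain ⟨k, hk⟩ := hJm hfJ
      have hle : m.map (algebraMap A B) ≤
          LinearMap.ker (LinearMap.toSpanSingleton B (B ⊗[A] M) (1 ⊗ₜ x)) := by
        rw [Ideal.map_le_iff_le_comap]
        intro a ha
        rw [Ideal.mem_comap, LinearMap.mem_ker, LinearMap.toSpanSingleton_apply,
          algebraMap_smul, ← TensorProduct.tmul_smul, hx a ha, TensorProduct.tmul_zero]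
      have h0 : f ^ k • (1 ⊗ₜ x : B ⊗[A] M) = 0 := hle hk
      exact (Module.FaithfullyFlat.one_tmul_eq_zero_iff A M (A := B) x).mp
        ((hf.pow k).right_eq_zero_of_smul h0)
    refine hasWeaklyRegularSeq_succ_iff.mpr ⟨a, ham, ha, ih ?_⟩
    exact (h.quotSMulTop (hmJ (Ideal.mem_map_of_mem _ ham))
      (ha.of_flat_of_isBaseChange (TensorProduct.isBaseChange A M B))).congr
      (QuotSMulTop.algebraMapTensorEquivTensorQuotSMulTop a M B)

lemma HasWeaklyRegularSeq.baseChange {B : Type*} [CommRing B] [Algebra A B] [Module.Flat A B]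
    {m : Ideal A} {d : ℕ} (h : HasWeaklyRegularSeq m M d) :
    HasWeaklyRegularSeq (m.map (algebraMap A B)) (B ⊗[A] M) d := by
  obtain ⟨rs, hm, hrs, rfl⟩ := h
  refine ⟨rs.map (algebraMap A B), ?_,
    hrs.of_flat_of_isBaseChange (TensorProduct.isBaseChange A M B), by simp⟩
  simp only [List.mem_map, forall_exists_index, and_imp, forall_apply_eq_imp_iff₂]
  exact fun r hr => Ideal.mem_map_of_mem _ (hm r hr)

lemma HasWeaklyRegularSeq.quotient_ringEquiv {B : Type*} [CommRing B] (e : A ≃+* B) {I : Ideal A}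
    {I' : Ideal B} (hI : I' = I.map (e : A →+* B)) {J' : Ideal B} (hJ : ∀ a ∈ J, e a ∈ J') {d : ℕ}
    (h : HasWeaklyRegularSeq J (A ⧸ I) d) : HasWeaklyRegularSeq J' (B ⧸ I') d := by
  obtain ⟨rs, hm, hrs, rfl⟩ := h
  refine ⟨rs.map e, ?_, ?_, by simp⟩
  · simp only [List.mem_map, forall_exists_index, and_imp, forall_apply_eq_imp_iff₂]
    exact fun r hr => hJ r (hm r hr)
  · refine (AddEquiv.isWeaklyRegular_congr (e := (Ideal.quotientEquiv I I' e hI).toAddEquiv)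
      (List.forall₂_map_right_iff.mpr (List.forall₂_same.mpr fun r _ x => ?_))).mp hrs
    obtain ⟨x, rfl⟩ := Ideal.Quotient.mk_surjective x
    change Ideal.quotientEquiv I I' e hI (Ideal.Quotient.mk I (r * x)) =
      Ideal.Quotient.mk I' (e r) * Ideal.quotientEquiv I I' e hI (Ideal.Quotient.mk I x)
    simp

end DepthExchange

section RootExtension

variable {σ : Type*} {K : Type*} [Field K] (i : σ) (w : ℕ)

variable (K) in
/-- The polynomial ring with a `w`-th root of `x_i` adjoined. -/
abbrev RootExt : Type _ :=
  AdjoinRoot (Polynomial.X ^ w - Polynomial.C (X i : MvPolynomial σ K))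

lemma root_pow : (AdjoinRoot.root _ : RootExt K i w) ^ w =
    algebraMap (MvPolynomial σ K) (RootExt K i w) (X i) := by
  have := AdjoinRoot.eval₂_root (Polynomial.X ^ w - Polynomial.C (X i : MvPolynomial σ K))
  rw [Polynomial.eval₂_sub, Polynomial.eval₂_pow, Polynomial.eval₂_X, Polynomial.eval₂_C,
    sub_eq_zero] at this
  exact this

variable [DecidableEq σ]

/-- The substitution `x_i ↦ x_i ^ w`, fixing the other variables. -/
def powSubst : MvPolynomial σ K →ₐ[K] MvPolynomial σ K :=
  aeval (Function.update X i (X i ^ w))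

/-- The map sending `x_i` to its adjoined root. -/
def toRootExt : MvPolynomial σ K →ₐ[K] RootExt K i w :=
  aeval (Function.update (fun j => algebraMap (MvPolynomial σ K) (RootExt K i w) (X j)) i
    (AdjoinRoot.root _))

/-- The map sending the adjoined root to `x_i`. -/
def ofRootExt : RootExt K i w →+* MvPolynomial σ K :=
  AdjoinRoot.lift (powSubst (K := K) i w : MvPolynomial σ K →+* MvPolynomial σ K) (X i)
    (by simp [powSubst])

lemma toRootExt_powSubst (p : MvPolynomial σ K) :
    toRootExt i w (powSubst i w p) = algebraMap (MvPolynomial σ K) (RootExt K i w) p := by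
  have : (toRootExt i w).comp (powSubst i w) =
      IsScalarTower.toAlgHom K (MvPolynomial σ K) (RootExt K i w) := by
    ext j
    obtain rfl | hj := eq_or_ne j i
    · simp [toRootExt, powSubst, root_pow]
    · simp [toRootExt, powSubst, hj]
  exact DFunLike.congr_fun this p

lemma ofRootExt_toRootExt (p : MvPolynomial σ K) : ofRootExt i w (toRootExt i w p) = p := by
  have : (ofRootExt i w).comp (toRootExt (K := K) i w : MvPolynomial σ K →+* RootExt K i w) =
      RingHom.id _ := by
    apply MvPolynomial.ringHom_ext
    · intro r
      simp [ofRootExt, toRootExt, AdjoinRoot.algebraMap_eq', powSubst, algebraMap_eq]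
    · intro j
      obtain rfl | hj := eq_or_ne j i
      · simp [toRootExt, ofRootExt]
      · simp [toRootExt, ofRootExt, hj, powSubst]
  exact DFunLike.congr_fun this p

lemma toRootExt_ofRootExt (p : RootExt K i w) : toRootExt i w (ofRootExt i w p) = p := by
  have : (toRootExt (K := K) i w : MvPolynomial σ K →+* RootExt K i w).comp (ofRootExt i w) =
      RingHom.id _ := by
    apply AdjoinRoot.ringHom_ext
    · refine RingHom.ext fun p => ?_
      simpa [ofRootExt] using toRootExt_powSubst i w p
    · simp [toRootExt, ofRootExt]
  exact DFunLike.congr_fun this p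

/-- Adjoining a `w`-th root of a variable gives a polynomial ring again. -/
def rootExtEquiv : MvPolynomial σ K ≃+* RootExt K i w :=
  { (toRootExt (K := K) i w : MvPolynomial σ K →+* RootExt K i w) with
    invFun := ofRootExt i w
    left_inv := ofRootExt_toRootExt i w
    right_inv := toRootExt_ofRootExt i w }

lemma map_rootExtEquiv_map_powSubst (I : Ideal (MvPolynomial σ K)) :
    (I.map (powSubst i w)).map (rootExtEquiv (K := K) i w : MvPolynomial σ K →+* RootExt K i w) =
      I.map (algebraMap (MvPolynomial σ K) (RootExt K i w)) := by
  rw [← Ideal.map_coe (powSubst i w), Ideal.map_map]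
  exact congrArg (Ideal.map · I) (RingHom.ext fun p => toRootExt_powSubst i w p)

variable {i w} [Finite σ]

lemma hasWeaklyRegularSeq_map_powSubst_iff (hw : w ≠ 0) {I m : Ideal (MvPolynomial σ K)}
    (hm : m.map (powSubst i w) ≤ m) (hm' : m ≤ (m.map (powSubst i w)).radical) {d : ℕ} :
    HasWeaklyRegularSeq m (MvPolynomial σ K ⧸ I.map (powSubst i w)) d ↔
      HasWeaklyRegularSeq m (MvPolynomial σ K ⧸ I) d := by
  set e := rootExtEquiv (K := K) i w
  have hmonic := Polynomial.monic_X_pow_sub_C (X i : MvPolynomial σ K) hw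
  have := hmonic.free_adjoinRoot
  have := hmonic.finite_adjoinRoot
  have : Nontrivial (RootExt K i w) := e.symm.toEquiv.nontrivial
  have : IsNoetherianRing (RootExt K i w) := isNoetherianRing_of_ringEquiv _ e
  have hI := map_rootExtEquiv_map_powSubst i w I
  have hmm := map_rootExtEquiv_map_powSubst i w m
  let t := (Algebra.TensorProduct.quotIdealMapEquivTensorQuot (RootExt K i w) I).toLinearEquiv
  constructor
  · intro h
    have h₁ := (h.quotient_ringEquiv e hI.symm
      (J' := m.map (e : MvPolynomial σ K →+* RootExt K i w))
      fun a ha => Ideal.mem_map_of_mem (e : MvPolynomial σ K →+* RootExt K i w) ha).congr t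
    refine h₁.of_faithfullyFlat ?_ ?_
    · rw [← hmm]
      exact Ideal.map_mono hm
    · rw [← hmm]
      exact (Ideal.map_mono hm').trans (Ideal.map_radical_le _)
  · intro h
    have h₁ := (h.baseChange (B := RootExt K i w)).congr t.symm
    refine h₁.quotient_ringEquiv e.symm ?_ fun a ha => ?_
    · rw [← hI, Ideal.map_of_equiv e]
    · rw [← hmm] at ha
      have := Ideal.mem_map_of_mem (e.symm : RootExt K i w →+* MvPolynomial σ K) ha
      rw [Ideal.map_of_equiv e] at this
      exact hm this

end RootExtension

section EdgeIdeal

variable {n : ℕ} {K : Type*} [Field K]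

variable (n K) in
/-- The irrelevant maximal ideal `(x_1, …, x_n)`. -/
abbrev irrelevantIdeal : Ideal (MvPolynomial (Fin n) K) :=
  Ideal.span (Set.range (X : Fin n → MvPolynomial (Fin n) K))

lemma irrelevantIdeal_ne_top : irrelevantIdeal n K ≠ ⊤ := by
  have hle : irrelevantIdeal n K ≤ RingHom.ker (constantCoeff (R := K) (σ := Fin n)) := by
    rw [Ideal.span_le]
    rintro _ ⟨j, rfl⟩
    simp [RingHom.mem_ker]
  exact ne_top_of_le_ne_top (RingHom.ker_ne_top _) hle

lemma isCohenMacaulayIdeal_iff {I : Ideal (MvPolynomial (Fin n) K)}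
    (hI : I ≤ irrelevantIdeal n K) :
    IsCohenMacaulayIdeal I ↔ ∃ d : ℕ,
      HasWeaklyRegularSeq (irrelevantIdeal n K) (MvPolynomial (Fin n) K ⧸ I) d ∧
      (d : WithBot ℕ∞) = ringKrullDim (MvPolynomial (Fin n) K ⧸ I) := by
  constructor
  · rintro ⟨rs, hrs, hreg, hdim⟩
    exact ⟨_, ⟨rs, hrs, hreg.toIsWeaklyRegular, rfl⟩, hdim⟩
  · rintro ⟨_, ⟨rs, hrs, hreg, rfl⟩, hdim⟩
    refine ⟨rs, hrs, ⟨hreg, fun htop => ?_⟩, hdim⟩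
    have hle : Ideal.ofList rs • (⊤ : Submodule _ (MvPolynomial (Fin n) K ⧸ I)) ≤
        LinearMap.ker (Submodule.factor hI) := by
      rw [Submodule.smul_le]
      intro r hr x _
      obtain ⟨x, rfl⟩ := Submodule.Quotient.mk_surjective _ x
      have hr' : r ∈ irrelevantIdeal n K := Ideal.span_le.mpr hrs hr
      rw [LinearMap.mem_ker, ← Submodule.Quotient.mk_smul]
      exact (Submodule.Quotient.mk_eq_zero _).mpr (Ideal.mul_mem_right _ _ hr')
    rw [← htop] at hle
    have h1 : (Submodule.Quotient.mk 1 : MvPolynomial (Fin n) K ⧸ irrelevantIdeal n K) = 0 :=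
      hle (Submodule.mem_top (x := Submodule.Quotient.mk 1))
    exact irrelevantIdeal_ne_top
      ((Ideal.eq_top_iff_one _).mpr ((Submodule.Quotient.mk_eq_zero _).mp h1))

lemma edgeIdeal_le_irrelevantIdeal (D : WOG n) : edgeIdeal K D ≤ irrelevantIdeal n K := by
  rw [edgeIdeal, Ideal.span_le]
  rintro _ ⟨j, k, -, rfl⟩
  exact Ideal.mul_mem_right _ _ (Ideal.subset_span ⟨j, rfl⟩)

lemma map_powSubst_irrelevantIdeal_le {i : Fin n} {w : ℕ} (hw : w ≠ 0) :
    (irrelevantIdeal n K).map (powSubst i w) ≤ irrelevantIdeal n K := by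
  have hX : ∀ j, X j ∈ irrelevantIdeal n K := fun j => Ideal.subset_span ⟨j, rfl⟩
  rw [Ideal.map_span, Ideal.span_le]
  rintro _ ⟨_, ⟨j, rfl⟩, rfl⟩
  obtain rfl | hj := eq_or_ne j i
  · simpa [powSubst] using Ideal.pow_mem_of_mem _ (hX j) w hw.bot_lt
  · simpa [powSubst, hj] using hX j

lemma irrelevantIdeal_le_radical_map_powSubst {i : Fin n} {w : ℕ} :
    irrelevantIdeal n K ≤ ((irrelevantIdeal n K).map (powSubst i w)).radical := by
  refine Ideal.span_le.mpr ?_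
  rintro _ ⟨j, rfl⟩
  have h : powSubst i w (X j) ∈ (irrelevantIdeal n K).map (powSubst i w) :=
    Ideal.mem_map_of_mem _ (Ideal.subset_span ⟨j, rfl⟩)
  obtain rfl | hj := eq_or_ne j i
  · exact ⟨w, by simpa [powSubst] using h⟩
  · exact Ideal.le_radical (by simpa [powSubst, hj] using h)

variable {D D' : WOG n} {i : Fin n}

lemma edgeIdeal_eq_map_powSubst (hsink : ∀ j, ¬ D.E i j) (hE : D'.E = D.E)
    (hd : D'.d = Function.update D.d i 1) :
    edgeIdeal K D = (edgeIdeal K D').map (powSubst i (D.d i)) := by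
  have key : ∀ j k, D.E j k → powSubst i (D.d i) (X j * X k ^ D'.d k) =
      (X j * X k ^ D.d k : MvPolynomial (Fin n) K) := by
    intro j k hjk
    have hj : j ≠ i := by
      rintro rfl
      exact hsink k hjk
    obtain rfl | hk := eq_or_ne k i
    · simp [powSubst, hd, hj]
    · simp [powSubst, hd, hj, hk]
  rw [edgeIdeal, edgeIdeal, Ideal.map_span]
  congr 1
  ext f
  constructor
  · rintro ⟨j, k, hjk, rfl⟩
    exact ⟨_, ⟨j, k, hE ▸ hjk, rfl⟩, key j k hjk⟩
  · rintro ⟨_, ⟨j, k, hjk, rfl⟩, rfl⟩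
    rw [hE] at hjk
    exact ⟨j, k, hjk, key j k hjk⟩

lemma radical_edgeIdeal_eq (hE : D'.E = D.E) :
    (edgeIdeal K D).radical = (edgeIdeal K D').radical := by
  have main : ∀ D D' : WOG n, D'.E = D.E → edgeIdeal K D ≤ (edgeIdeal K D').radical := by
    intro D D' hE
    refine Ideal.span_le.mpr ?_
    rintro _ ⟨j, k, hjk, rfl⟩
    have hmem : (X j * X k ^ D'.d k : MvPolynomial (Fin n) K) ∈ edgeIdeal K D' :=
      Ideal.subset_span ⟨j, k, hE ▸ hjk, rfl⟩
    have hd := D.dpos k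
    have hd' := D'.dpos k
    refine ⟨D'.d k, Ideal.mem_of_dvd _ ?_ hmem⟩
    rw [mul_pow, ← pow_mul]
    exact mul_dvd_mul (dvd_pow_self _ (by lia)) (pow_dvd_pow _ (Nat.le_mul_of_pos_left _ hd))
  exact le_antisymm (Ideal.radical_le_radical_iff.mpr (main D D' hE))
    (Ideal.radical_le_radical_iff.mpr (main D' D hE.symm))

lemma ringKrullDim_quotient_eq_of_radical_eq {R : Type*} [CommRing R] {I I' : Ideal R}
    (h : I.radical = I'.radical) : ringKrullDim (R ⧸ I) = ringKrullDim (R ⧸ I') := by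
  rw [ringKrullDim_quotient, ringKrullDim_quotient, PrimeSpectrum.zeroLocus_eq_iff.mpr h]

end EdgeIdeal

/-- If `x_i` is a sink of a vertex-weighted oriented graph `D` and `D'` is
obtained from `D` by replacing the weight of `x_i` with `1`, then `I(D)` is Cohen–Macaulay
iff `I(D')` is Cohen–Macaulay. -/
theorem edgeIdeal_cm_iff_sink_weight_one
    {n : ℕ} (K : Type*) [Field K] (D D' : WOG n) (i : Fin n)
    (hsink : ∀ j, ¬ D.E i j)
    (hE : D'.E = D.E)
    (hd : D'.d = Function.update D.d i 1) :
    IsCohenMacaulayIdeal (edgeIdeal K D) ↔ IsCohenMacaulayIdeal (edgeIdeal K D') := by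
  rw [isCohenMacaulayIdeal_iff (edgeIdeal_le_irrelevantIdeal D),
    isCohenMacaulayIdeal_iff (edgeIdeal_le_irrelevantIdeal D'),
    ringKrullDim_quotient_eq_of_radical_eq (radical_edgeIdeal_eq hE)]
  have hw : D.d i ≠ 0 := Nat.ne_of_gt (D.dpos i)
  rw [edgeIdeal_eq_map_powSubst (K := K) hsink hE hd]
  exact exists_congr fun d => and_congr_left' <|
    hasWeaklyRegularSeq_map_powSubst_iff hw (map_powSubst_irrelevantIdeal_le hw)
      irrelevantIdeal_le_radical_map_powSubst
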